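/- The integral decomposition of a nonempty finite subset B of Λ into irreducible subsets is unique up to order: if B = B₁ ∪ … ∪ B_k and B = B'₁ ∪ … ∪ B'_m are two integral decompositions of B into irreducible subsets, then {B₁, …, B_k} = {B'₁, …, B'_m} as families of subsets of Λ. -/

import Mathlib

open TensorProduct

variable {Λ : Type*} [AddCommGroup Λ]

/-- The completion (saturation) `Δ̄ = {λ ∈ Λ : m • λ ∈ Δ for some m > 0}` of a sublattice. -/
def completion (Δ : Submodule ℤ Λ) : Submodule ℤ Λ where
  carrier := {x | ∃ m : ℤ, 0 < m ∧ m • x ∈ Δ}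
  zero_mem' := ⟨1, one_pos, by rw [one_smul]; exact Δ.zero_mem⟩
  add_mem' := by
    rintro a b ⟨m, hm, hma⟩ ⟨k, hk, hkb⟩
    refine ⟨m * k, mul_pos hm hk, ?_⟩
    rw [show (m * k) • (a + b) = k • (m • a) + m • (k • b) by
      rw [smul_add, mul_comm m k, mul_smul, mul_smul, smul_comm k m b]]
    exact Δ.add_mem (Δ.smul_mem _ hma) (Δ.smul_mem _ hkb)
  smul_mem' := by
    rintro c x ⟨m, hm, hmx⟩
    exact ⟨m, hm, by rw [smul_comm]; exact Δ.smul_mem c hmx⟩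

/-- The completion of the sublattice spanned by a subset `B ⊆ Λ`. -/
def zcomp (B : Set Λ) : Submodule ℤ Λ := completion (Submodule.span ℤ B)

/-- An integral decomposition of `B`: the parts (the elements of the finite family `P`)
are pairwise disjoint and nonempty, they cover `B`, and the completion of `⟨B⟩ℤ` is the
internal direct sum of the completions of the spans of the parts. -/
def IsIntegralDecomp (B : Set Λ) (P : Finset (Set Λ)) : Prop :=
  (∀ p ∈ P, p.Nonempty) ∧
  ((P : Set (Set Λ)).Pairwise fun p q => Disjoint p q) ∧
  ⋃₀ (P : Set (Set Λ)) = B ∧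
  (zcomp B = ⨆ p ∈ P, zcomp p) ∧
  iSupIndep (fun p : P => zcomp (p : Set Λ))

/-- `B` is irreducible if it admits no integral decomposition with at least two parts. -/
def IrreducibleSubset (B : Set Λ) : Prop :=
  ¬ ∃ P : Finset (Set Λ), 2 ≤ P.card ∧ IsIntegralDecomp B P

lemma zcomp_mono {A B : Set Λ} (h : A ⊆ B) : zcomp A ≤ zcomp B := by
  rintro x ⟨m, hm, hx⟩
  exact ⟨m, hm, Submodule.span_mono h hx⟩

lemma span_le_zcomp (A : Set Λ) : Submodule.span ℤ A ≤ zcomp A :=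
  fun x hx => ⟨1, one_pos, by rwa [one_smul]⟩

lemma zcomp_empty [Module.IsTorsionFree ℤ Λ] : zcomp (∅ : Set Λ) = ⊥ := by
  refine (Submodule.eq_bot_iff _).2 ?_
  rintro x ⟨m, hm, hx⟩
  rw [Submodule.span_empty, Submodule.mem_bot] at hx
  exact (smul_eq_zero.1 hx).resolve_left hm.ne'

open Classical in
/-- The nonempty traces on `p` of the members of the family `Q`. -/
noncomputable def traceParts {α : Type*} (Q : Finset (Set α)) (p : Set α) : Finset (Set α) :=
  (Q.image fun q => p ∩ q).filter Set.Nonempty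

lemma mem_traceParts {α : Type*} {Q : Finset (Set α)} {p r : Set α} :
    r ∈ traceParts Q p ↔ (∃ q ∈ Q, p ∩ q = r) ∧ r.Nonempty := by
  classical
  simp [traceParts]

lemma iSupIndep_unique_sum {ι : Type*} [Fintype ι] {S : ι → Submodule ℤ Λ}
    (hS : iSupIndep S) {f g : ι → Λ} (hf : ∀ i, f i ∈ S i) (hg : ∀ i, g i ∈ S i)
    (h : ∑ i, f i = ∑ i, g i) (i : ι) : f i = g i := by
  classical
  have hinj := hS.dfinsupp_lsum_injective
  have key : DFinsupp.equivFunOnFintype.symm (fun i => (⟨f i, hf i⟩ : S i)) =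
      DFinsupp.equivFunOnFintype.symm (fun i => (⟨g i, hg i⟩ : S i)) := by
    apply hinj
    simp only [DFinsupp.lsum_apply_apply, DFinsupp.sumAddHom_apply,
      DFinsupp.sum_eq_sum_fintype, map_zero, implies_true]
    exact h
  exact congrArg Subtype.val (DFunLike.congr_fun key i)

/-- An integral decomposition of `B` induces one of each of its subsets. -/
lemma IsIntegralDecomp.trace [Module.IsTorsionFree ℤ Λ] {B : Set Λ}
    {Q : Finset (Set Λ)} (hQ : IsIntegralDecomp B Q) {p : Set Λ} (hp : p ⊆ B) :
    IsIntegralDecomp p (traceParts Q p) := by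
  obtain ⟨-, hdisj, hcov, hsup, hind⟩ := hQ
  have hpcov : ∀ x ∈ p, ∃ q ∈ Q, x ∈ q := (hcov ▸ hp : p ⊆ ⋃₀ (Q : Set (Set Λ)))
  refine ⟨fun r hr => (mem_traceParts.1 hr).2, ?_, ?_, le_antisymm ?_ ?_, ?_⟩
  · intro r hr s hs hne
    obtain ⟨⟨q, hq, rfl⟩, -⟩ := mem_traceParts.1 hr
    obtain ⟨⟨q', hq', rfl⟩, -⟩ := mem_traceParts.1 hs
    have hqq : q ≠ q' := fun h => hne (by rw [h])
    exact (hdisj hq hq' hqq).mono Set.inter_subset_right Set.inter_subset_right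
  · ext x
    constructor
    · rintro ⟨r, hr, hx⟩
      obtain ⟨⟨q, hq, rfl⟩, -⟩ := mem_traceParts.1 hr
      exact hx.1
    · intro hx
      obtain ⟨q, hq, hxq⟩ := hpcov x hx
      exact ⟨p ∩ q, mem_traceParts.2 ⟨⟨q, hq, rfl⟩, ⟨x, hx, hxq⟩⟩, hx, hxq⟩
  · intro x hx
    have hxB : x ∈ ⨆ q ∈ Q, zcomp q := hsup ▸ zcomp_mono hp hx
    obtain ⟨m, hm, hmx⟩ := hx
    have hspan : Submodule.span ℤ p ≤ ⨆ q ∈ Q, Submodule.span ℤ (p ∩ q) := by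
      refine Submodule.span_le.2 fun y hy => ?_
      obtain ⟨q, hq, hyq⟩ := hpcov y hy
      exact Submodule.mem_iSup_of_mem q
        (Submodule.mem_iSup_of_mem hq (Submodule.subset_span ⟨hy, hyq⟩))
    obtain ⟨f, hf⟩ := (Submodule.mem_iSup_finset_iff_exists_sum _ _).1 hxB
    obtain ⟨g, hg⟩ := (Submodule.mem_iSup_finset_iff_exists_sum _ _).1 (hspan hmx)
    have hfg : ∀ q : Q, m • (f q : Λ) = g q := by
      refine iSupIndep_unique_sum hind (fun q => Submodule.smul_mem _ _ (f q).2)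
        (fun q => zcomp_mono Set.inter_subset_right (span_le_zcomp _ (g q).2)) ?_
      rw [← Finset.smul_sum, Finset.sum_coe_sort Q (fun q => (f q : Λ)),
        Finset.sum_coe_sort Q (fun q => (g q : Λ)), hf, hg]
    rw [← hf]
    refine Submodule.sum_mem _ fun q hq => ?_
    have hfq : (f q : Λ) ∈ zcomp (p ∩ q) := ⟨m, hm, by rw [hfg ⟨q, hq⟩]; exact (g q).2⟩
    by_cases hne : (p ∩ q).Nonempty
    · exact Submodule.mem_iSup_of_mem (p ∩ q)
        (Submodule.mem_iSup_of_mem (mem_traceParts.2 ⟨⟨q, hq, rfl⟩, hne⟩) hfq)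
    · rw [Set.not_nonempty_iff_eq_empty.1 hne, zcomp_empty, Submodule.mem_bot] at hfq
      rw [hfq]
      exact Submodule.zero_mem _
  · refine iSup₂_le fun r hr => ?_
    obtain ⟨⟨q, hq, rfl⟩, -⟩ := mem_traceParts.1 hr
    exact zcomp_mono Set.inter_subset_left
  · choose φ hφ hφr using fun r : traceParts Q p => (mem_traceParts.1 r.2).1
    have hinj : Function.Injective fun r : traceParts Q p => (⟨φ r, hφ r⟩ : Q) := by
      intro r s h
      have h' : φ r = φ s := congrArg Subtype.val h
      exact Subtype.ext (by rw [← hφr r, ← hφr s, h'])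
    refine (hind.comp hinj).mono fun r => ?_
    conv_lhs => rw [← hφr r]
    exact zcomp_mono Set.inter_subset_right

/-- A nonempty irreducible subset of `B` lies in a part of any integral decomposition. -/
lemma IsIntegralDecomp.exists_subset_of_irreducible [Module.IsTorsionFree ℤ Λ] {B : Set Λ}
    {Q : Finset (Set Λ)} (hQ : IsIntegralDecomp B Q) {p : Set Λ} (hp : p ⊆ B) (hne : p.Nonempty)
    (hirr : IrreducibleSubset p) : ∃ q ∈ Q, p ⊆ q := by
  have hcard : (traceParts Q p).card ≤ 1 := by
    by_contra h
    exact hirr ⟨_, by omega, hQ.trace hp⟩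
  have hpcov : ∀ x ∈ p, ∃ q ∈ Q, x ∈ q := (hQ.2.2.1 ▸ hp : p ⊆ ⋃₀ (Q : Set (Set Λ)))
  obtain ⟨x, hx⟩ := hne
  obtain ⟨q, hq, hxq⟩ := hpcov x hx
  refine ⟨q, hq, fun y hy => ?_⟩
  obtain ⟨q', hq', hyq'⟩ := hpcov y hy
  have h := Finset.card_le_one.1 hcard (p ∩ q') (mem_traceParts.2 ⟨⟨q', hq', rfl⟩, y, hy, hyq'⟩)
    (p ∩ q) (mem_traceParts.2 ⟨⟨q, hq, rfl⟩, x, hx, hxq⟩)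
  exact (h ▸ (⟨hy, hyq'⟩ : y ∈ p ∩ q') : y ∈ p ∩ q).2

/-- A decomposition into irreducible subsets is contained in any other one. -/
lemma IsIntegralDecomp.subset_of_irreducible [Module.IsTorsionFree ℤ Λ] {B : Set Λ}
    {P Q : Finset (Set Λ)}
    (hP : IsIntegralDecomp B P) (hPirr : ∀ p ∈ P, IrreducibleSubset p)
    (hQ : IsIntegralDecomp B Q) (hQirr : ∀ q ∈ Q, IrreducibleSubset q) : P ⊆ Q := by
  intro p hp
  have hsub : ∀ {R : Finset (Set Λ)}, IsIntegralDecomp B R → ∀ r ∈ R, r ⊆ B :=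
    fun hR r hr => hR.2.2.1 ▸ Set.subset_sUnion_of_mem hr
  obtain ⟨q, hq, hpq⟩ :=
    hQ.exists_subset_of_irreducible (hsub hP p hp) (hP.1 p hp) (hPirr p hp)
  obtain ⟨p', hp', hqp'⟩ :=
    hP.exists_subset_of_irreducible (hsub hQ q hq) (hQ.1 q hq) (hQirr q hq)
  have hpp' : p = p' := by
    by_contra hne
    obtain ⟨x, hx⟩ := hP.1 p hp
    exact Set.disjoint_left.1 (hP.2.1 hp hp' hne) hx (hqp' (hpq hx))
  rw [hpq.antisymm (hpp' ▸ hqp')]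
  exact hq

variable [Module.Free ℤ Λ] [Module.Finite ℤ Λ]

/-- The integral decomposition of a nonempty finite subset of `Λ` into irreducible subsets
is unique up to order. -/
theorem decomposition_into_irreducibles_unique
    (B : Set Λ) (hBfin : B.Finite) (hBne : B.Nonempty)
    (P Q : Finset (Set Λ))
    (hP : IsIntegralDecomp B P) (hPirr : ∀ p ∈ P, IrreducibleSubset p)
    (hQ : IsIntegralDecomp B Q) (hQirr : ∀ q ∈ Q, IrreducibleSubset q) :
    P = Q := by
  exact (hP.subset_of_irreducible hPirr hQ hQirr).antisymm
    (hQ.subset_of_irreducible hQirr hP hPirr)
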